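/- arXiv:2301.05357 — 4 statements merged into one kernel-verified Lean document; each statement's English description precedes it below -/
import Mathlib

section
/- Let P be a real m×n matrix with full row rank (rank(P) = m ≤ n) and let D be a real n×n symmetric positive definite matrix. Then the condition number of P D Pᵀ satisfies κ(P D Pᵀ) ≤ κ(D) · κ(P Pᵀ). -/
open Matrix BigOperators

/-- Condition number of a Hermitian matrix: ratio of its largest to its smallest eigenvalue. -/
noncomputable def condNumber {n : ℕ} {B : Matrix (Fin n) (Fin n) ℝ}
    (hB : B.IsHermitian) : ℝ :=
  (⨆ i, hB.eigenvalues i) / (⨅ i, hB.eigenvalues i)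

theorem aux_quad {n : ℕ} {B : Matrix (Fin n) (Fin n) ℝ} (hB : B.IsHermitian) (x : Fin n → ℝ) :
    ∃ y : Fin n → ℝ, (∑ i, y i ^ 2 = x ⬝ᵥ x) ∧
      x ⬝ᵥ (B *ᵥ x) = ∑ i, hB.eigenvalues i * y i ^ 2 := by
  have hU : (hB.eigenvectorUnitary : Matrix (Fin n) (Fin n) ℝ) *
      (hB.eigenvectorUnitary : Matrix (Fin n) (Fin n) ℝ)ᵀ = 1 := by
    have := (Matrix.mem_unitaryGroup_iff).1 hB.eigenvectorUnitary.2
    simpa [Matrix.star_eq_conjTranspose, Matrix.conjTranspose_eq_transpose_of_trivial] using this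
  have hs : B = (hB.eigenvectorUnitary : Matrix (Fin n) (Fin n) ℝ) *
      Matrix.diagonal hB.eigenvalues *
      (hB.eigenvectorUnitary : Matrix (Fin n) (Fin n) ℝ)ᵀ := by
    have := hB.spectral_theorem
    rw [Unitary.conjStarAlgAut_apply] at this
    simpa [Matrix.star_eq_conjTranspose, Matrix.conjTranspose_eq_transpose_of_trivial,
      Function.comp_def] using this
  generalize hB.eigenvalues = l at *
  generalize (hB.eigenvectorUnitary : Matrix (Fin n) (Fin n) ℝ) = U at *
  refine ⟨Uᵀ *ᵥ x, ?_, ?_⟩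
  · have : (Uᵀ *ᵥ x) ⬝ᵥ (Uᵀ *ᵥ x) = x ⬝ᵥ x := by
      rw [Matrix.dotProduct_mulVec, Matrix.vecMul_transpose, Matrix.mulVec_mulVec, hU,
        Matrix.one_mulVec]
    rw [← this]
    simp [dotProduct, sq]
  · have : x ⬝ᵥ (B *ᵥ x) = (Uᵀ *ᵥ x) ⬝ᵥ (Matrix.diagonal l *ᵥ (Uᵀ *ᵥ x)) := by
      rw [hs, ← Matrix.mulVec_mulVec, ← Matrix.mulVec_mulVec, Matrix.dotProduct_mulVec x,
        ← Matrix.mulVec_transpose]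
    rw [this]
    simp only [dotProduct, Matrix.mulVec_diagonal]
    exact Finset.sum_congr rfl fun i _ => by ring

theorem aux_bounds {n : ℕ} {B : Matrix (Fin n) (Fin n) ℝ} (hB : B.IsHermitian) (x : Fin n → ℝ) :
    (⨅ i, hB.eigenvalues i) * (x ⬝ᵥ x) ≤ x ⬝ᵥ (B *ᵥ x) ∧
      x ⬝ᵥ (B *ᵥ x) ≤ (⨆ i, hB.eigenvalues i) * (x ⬝ᵥ x) := by
  obtain ⟨y, h1, h2⟩ := aux_quad hB x
  rw [h2, ← h1, Finset.mul_sum, Finset.mul_sum]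
  constructor
  · exact Finset.sum_le_sum fun i _ => mul_le_mul_of_nonneg_right
      (ciInf_le (Set.finite_range _).bddBelow i) (sq_nonneg _)
  · exact Finset.sum_le_sum fun i _ => mul_le_mul_of_nonneg_right
      (le_ciSup (Set.finite_range _).bddAbove i) (sq_nonneg _)

theorem aux_vec {n : ℕ} {B : Matrix (Fin n) (Fin n) ℝ} (hB : B.IsHermitian) (i : Fin n) :
    ∃ v : Fin n → ℝ, v ⬝ᵥ v = 1 ∧ v ⬝ᵥ (B *ᵥ v) = hB.eigenvalues i := by
  have h1 : (hB.eigenvectorBasis i : Fin n → ℝ) ⬝ᵥ (hB.eigenvectorBasis i : Fin n → ℝ) = 1 := by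
    have h := hB.eigenvectorBasis.orthonormal.1 i
    have h2 : ‖hB.eigenvectorBasis i‖ ^ 2 = 1 := by rw [h]; norm_num
    rw [EuclideanSpace.real_norm_sq_eq] at h2
    rw [← h2]
    simp [dotProduct, sq]
  refine ⟨hB.eigenvectorBasis i, h1, ?_⟩
  rw [hB.mulVec_eigenvectorBasis, dotProduct_smul, h1]
  simp

/-- For a real `m × n` matrix `P` of full row rank (`rank P = m ≤ n`) and a
real symmetric positive definite `n × n` matrix `D`, the condition number of `P * D * Pᵀ`
satisfies `κ(P D Pᵀ) ≤ κ(D) ⬝ κ(P Pᵀ)`. -/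
theorem cond_mul_le_cond_mul_cond {m n : ℕ} (hm : 0 < m) (hmn : m ≤ n)
    (P : Matrix (Fin m) (Fin n) ℝ) (hP : P.rank = m)
    (D : Matrix (Fin n) (Fin n) ℝ) (hD : D.PosDef)
    (hPDP : (P * D * Pᵀ).IsHermitian) (hPP : (P * Pᵀ).IsHermitian) :
    condNumber hPDP ≤ condNumber hD.1 * condNumber hPP := by
  have : Nonempty (Fin m) := ⟨⟨0, hm⟩⟩
  have : Nonempty (Fin n) := ⟨⟨0, hm.trans_le hmn⟩⟩
  have hPPv (v : Fin m → ℝ) : v ⬝ᵥ ((P * Pᵀ) *ᵥ v) = (Pᵀ *ᵥ v) ⬝ᵥ (Pᵀ *ᵥ v) := by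
    rw [← Matrix.mulVec_mulVec, Matrix.dotProduct_mulVec v, ← Matrix.mulVec_transpose]
  have hPDv (v : Fin m → ℝ) :
      v ⬝ᵥ ((P * D * Pᵀ) *ᵥ v) = (Pᵀ *ᵥ v) ⬝ᵥ (D *ᵥ (Pᵀ *ᵥ v)) := by
    rw [← Matrix.mulVec_mulVec, ← Matrix.mulVec_mulVec, Matrix.dotProduct_mulVec v,
      ← Matrix.mulVec_transpose]
  have hinj : Function.Injective (Pᵀ).mulVec := by
    rw [Matrix.mulVec_injective_iff, Matrix.col_transpose]
    rw [linearIndependent_iff_card_eq_finrank_span, Set.finrank, ← Matrix.rank_eq_finrank_span_row, hP]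
    simp
  have hd : 0 < ⨅ i, hD.1.eigenvalues i := by
    obtain ⟨i, hi⟩ := exists_eq_ciInf_of_finite (f := hD.1.eigenvalues)
    rw [← hi]; exact hD.eigenvalues_pos i
  have hp : 0 < ⨅ i, hPP.eigenvalues i := by
    obtain ⟨i, hi⟩ := exists_eq_ciInf_of_finite (f := hPP.eigenvalues)
    rw [← hi]
    obtain ⟨v, hv, hv2⟩ := aux_vec hPP i
    rw [← hv2, hPPv]
    have hne : Pᵀ *ᵥ v ≠ 0 := by
      intro h
      have : v = 0 := hinj (by simpa using h)
      simp [this] at hv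
    refine lt_of_le_of_ne (Finset.sum_nonneg fun i _ => mul_self_nonneg _) fun h => hne ?_
    exact dotProduct_self_eq_zero.1 h.symm
  have hds : 0 < ⨆ i, hD.1.eigenvalues i := hd.trans_le
    (ciInf_le_ciSup (Set.finite_range _).bddBelow (Set.finite_range _).bddAbove)
  have key (i : Fin m) :
      (⨅ i, hD.1.eigenvalues i) * (⨅ i, hPP.eigenvalues i) ≤ hPDP.eigenvalues i ∧
      hPDP.eigenvalues i ≤ (⨆ i, hD.1.eigenvalues i) * (⨆ i, hPP.eigenvalues i) := by
    obtain ⟨v, hv, hv2⟩ := aux_vec hPDP i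
    obtain ⟨a, b⟩ := aux_bounds hD.1 (Pᵀ *ᵥ v)
    obtain ⟨c, d⟩ := aux_bounds hPP v
    rw [hPPv, hv, mul_one] at c d
    rw [← hv2, hPDv]
    exact ⟨(mul_le_mul_of_nonneg_left c hd.le).trans a,
      b.trans (mul_le_mul_of_nonneg_left d hds.le)⟩
  have hps : 0 < ⨆ i, hPP.eigenvalues i := hp.trans_le
    (ciInf_le_ciSup (Set.finite_range _).bddBelow (Set.finite_range _).bddAbove)
  unfold condNumber
  rw [div_mul_div_comm]
  exact div_le_div₀ (mul_pos hds hps).le (ciSup_le fun i => (key i).2) (mul_pos hd hp)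
    (le_ciInf fun i => (key i).1)
end

section
/- Let Q ∈ ℝ^{n×n} be symmetric positive semidefinite, V ∈ ℝ^{n×(n−m)}, and let X, S be positive diagonal n×n matrices satisfying X S = μ(I + θE) for some μ > 0, θ > 0 and diagonal matrix E with ‖E‖_F ≤ 1. Then trace(X Q V Vᵀ S) ≥ μ·( trace(Vᵀ Q V) − θ‖Q V Vᵀ‖_F ). In particular, if additionally θ ≤ 1/(4‖Q V Vᵀ‖_F + 1), then trace(X Q V Vᵀ S) ≥ −μ/4. -/
open Matrix BigOperators

/-- Frobenius norm of a real matrix. -/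
noncomputable def fnorm {ι κ : Type*} [Fintype ι] [Fintype κ] (M : Matrix ι κ ℝ) : ℝ :=
  Real.sqrt (∑ i, ∑ j, (M i j) ^ 2)

theorem fnorm_trace_aux {ι : Type*} [Fintype ι] (A B : Matrix ι ι ℝ) :
    -(fnorm A * fnorm B) ≤ (A * B).trace := by
  have h1 : (A * B).trace = ∑ p : ι × ι, A p.1 p.2 * B p.2 p.1 := by
    simp [Matrix.trace, Matrix.mul_apply, Fintype.sum_prod_type]
  have h2 := Real.sum_mul_le_sqrt_mul_sqrt Finset.univ
    (fun p : ι × ι => -A p.1 p.2) (fun p : ι × ι => B p.2 p.1)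
  have hA : fnorm A = Real.sqrt (∑ p : ι × ι, (-A p.1 p.2) ^ 2) := by
    simp [fnorm, Fintype.sum_prod_type]
  have hB : fnorm B = Real.sqrt (∑ p : ι × ι, (B p.2 p.1) ^ 2) := by
    rw [fnorm, Fintype.sum_prod_type, Finset.sum_comm]
  rw [hA, hB, h1]
  simp only [neg_mul, Finset.sum_neg_distrib] at h2
  linarith

/-- For `Q` symmetric positive semidefinite, `X, S` positive diagonal with
`X S = μ(I + θ E)`, `‖E‖_F ≤ 1`, one has
`trace(X Q V Vᵀ S) ≥ μ (trace(Vᵀ Q V) − θ ‖Q V Vᵀ‖_F)`; and if moreover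
`θ ≤ 1/(4‖Q V Vᵀ‖_F + 1)` then `trace(X Q V Vᵀ S) ≥ −μ/4`. -/
theorem trace_XQVVTS_lower_bound {m n : ℕ}
    (Q : Matrix (Fin n) (Fin n) ℝ) (hQ : Q.PosSemidef)
    (V : Matrix (Fin n) (Fin (n - m)) ℝ)
    (x s : Fin n → ℝ) (hx : ∀ i, 0 < x i) (hs : ∀ i, 0 < s i)
    (X S : Matrix (Fin n) (Fin n) ℝ)
    (hX : X = Matrix.diagonal x) (hS : S = Matrix.diagonal s)
    (μ θ : ℝ) (hμ : 0 < μ) (hθ : 0 < θ)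
    (E : Matrix (Fin n) (Fin n) ℝ) (hEdiag : E.IsDiag) (hEF : fnorm E ≤ 1)
    (hXS : X * S = μ • ((1 : Matrix (Fin n) (Fin n) ℝ) + θ • E)) :
    μ * ((Vᵀ * Q * V).trace - θ * fnorm (Q * V * Vᵀ)) ≤ (X * Q * V * Vᵀ * S).trace ∧
      (θ ≤ 1 / (4 * fnorm (Q * V * Vᵀ) + 1) → -(μ / 4) ≤ (X * Q * V * Vᵀ * S).trace) := by
  have hcomm : S * X = X * S := by
    rw [hX, hS, Matrix.diagonal_mul_diagonal, Matrix.diagonal_mul_diagonal]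
    simp only [mul_comm]
  have hT : (X * Q * V * Vᵀ * S).trace
      = μ * ((Vᵀ * Q * V).trace + θ * (E * (Q * V * Vᵀ)).trace) := by
    have h1 : (Vᵀ * Q * V).trace = (Q * V * Vᵀ).trace := by
      rw [Matrix.mul_assoc, Matrix.trace_mul_comm]
    have h2 : S * (X * Q * V * Vᵀ) = (S * X) * (Q * V * Vᵀ) := by
      simp only [Matrix.mul_assoc]
    rw [Matrix.trace_mul_comm, h2, hcomm, hXS, h1]
    simp [Matrix.add_mul, Matrix.trace_add, Matrix.trace_smul]
    try ring
  have hN : 0 ≤ fnorm (Q * V * Vᵀ) := Real.sqrt_nonneg _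
  have hE := fnorm_trace_aux E (Q * V * Vᵀ)
  have hE2 : -fnorm (Q * V * Vᵀ) ≤ (E * (Q * V * Vᵀ)).trace := by nlinarith
  have main : μ * ((Vᵀ * Q * V).trace - θ * fnorm (Q * V * Vᵀ))
      ≤ (X * Q * V * Vᵀ * S).trace := by
    rw [hT]
    apply mul_le_mul_of_nonneg_left _ hμ.le
    have := mul_le_mul_of_nonneg_left hE2 hθ.le
    linarith
  refine ⟨main, fun h => le_trans ?_ main⟩
  have hp : 0 ≤ (Vᵀ * Q * V).trace := by
    have := (hQ.conjTranspose_mul_mul_same V).trace_nonneg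
    simpa using this
  rw [le_div_iff₀ (by positivity)] at h
  have h3 : -(1 / 4) ≤ (Vᵀ * Q * V).trace - θ * fnorm (Q * V * Vᵀ) := by nlinarith
  have := mul_le_mul_of_nonneg_left h3 hμ.le
  linarith
end

section
/- Let x, s ∈ ℝⁿ with x, s > 0, μ > 0, and suppose x_i s_i = μ(1 + θE_{ii}) for all i, where E is diagonal with |E_{ii}| ≤ 1 for all i and 0 < θ ≤ 1/(3√n) with n ≥ 1. Then the matrix Ψ₁ = [S², −μθE; −μθE, X²] is symmetric positive definite, and every eigenvalue of Ψ₁ is at least μ²/(3·max_i(x_i² + s_i²)). -/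
open Matrix BigOperators


theorem psi_scalar (x s c e a b : ℝ) (hx : 0 < x) (hs : 0 < s) (hc : 0 < c)
    (h : c * (x ^ 2 + s ^ 2) ≤ (x * s) ^ 2 - e ^ 2) :
    c * (a ^ 2 + b ^ 2) ≤ s ^ 2 * a ^ 2 - 2 * e * a * b + x ^ 2 * b ^ 2 := by
  have hp : 0 < s ^ 2 - c := by
    have h1 : 0 < c * s ^ 2 := by positivity
    have h2 : 0 < x ^ 2 * (s ^ 2 - c) := by nlinarith [sq_nonneg e]
    exact pos_of_mul_pos_right h2 (by positivity)
  have h3 : 0 ≤ (s ^ 2 - c) * (s ^ 2 * a ^ 2 - 2 * e * a * b + x ^ 2 * b ^ 2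
      - c * (a ^ 2 + b ^ 2)) := by
    have h4 : 0 ≤ (s ^ 2 - c) * (x ^ 2 - c) - e ^ 2 := by nlinarith [sq_nonneg c]
    have h5 := mul_nonneg h4 (sq_nonneg b)
    nlinarith [sq_nonneg ((s ^ 2 - c) * a - e * b)]
  have := nonneg_of_mul_nonneg_right h3 hp
  linarith

/-- Under the central-path neighbourhood conditions with
`0 < θ ≤ 1/(3√n)`, the matrix `Ψ₁ = [S², −μθE; −μθE, X²]` is symmetric positive definite,
and every eigenvalue of `Ψ₁` is at least `μ²/(3 maxᵢ (xᵢ² + sᵢ²))`. -/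
theorem Psi1_posdef_and_eigenvalue_lower_bound {n : ℕ} (hn : 0 < n)
    (x s : Fin n → ℝ) (hx : ∀ i, 0 < x i) (hs : ∀ i, 0 < s i)
    (μ θ : ℝ) (hμ : 0 < μ)
    (E : Matrix (Fin n) (Fin n) ℝ) (hEdiag : E.IsDiag) (hE : ∀ i, |E i i| ≤ 1)
    (hxs : ∀ i, x i * s i = μ * (1 + θ * E i i))
    (hθ0 : 0 < θ) (hθ : θ ≤ 1 / (3 * Real.sqrt n))
    (X S : Matrix (Fin n) (Fin n) ℝ)
    (hX : X = Matrix.diagonal x) (hS : S = Matrix.diagonal s)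
    (Ψ₁ : Matrix (Fin n ⊕ Fin n) (Fin n ⊕ Fin n) ℝ)
    (hΨ₁ : Ψ₁ = fromBlocks (S ^ 2) (-((μ * θ) • E)) (-((μ * θ) • E)) (X ^ 2)) :
    Ψ₁.PosDef ∧
      ∀ q ∈ spectrum ℝ Ψ₁, μ ^ 2 / (3 * ⨆ i, (x i ^ 2 + s i ^ 2)) ≤ q := by
  have hT : ∀ i, x i ^ 2 + s i ^ 2 ≤ ⨆ i, (x i ^ 2 + s i ^ 2) := fun i =>
    le_ciSup (f := fun i => x i ^ 2 + s i ^ 2) (Set.finite_range _).bddAbove i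
  set M := ⨆ i, (x i ^ 2 + s i ^ 2) with hM
  have hMpos : 0 < M := by
    have h1 := hT ⟨0, hn⟩
    have h2 := hx ⟨0, hn⟩
    have h3 : 0 < x ⟨0, hn⟩ ^ 2 + s ⟨0, hn⟩ ^ 2 := by positivity
    linarith
  set c := μ ^ 2 / (3 * M) with hc
  have hcpos : 0 < c := by positivity
  have hcM : c * M = μ ^ 2 / 3 := by rw [hc]; field_simp
  have hθ3 : θ ≤ 1 / 3 := by
    refine hθ.trans ?_
    have h1 : (1 : ℝ) ≤ Real.sqrt n := by
      rw [Real.one_le_sqrt]; exact_mod_cast hn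
    exact one_div_le_one_div_of_le (by norm_num) (by linarith)
  have hdet : ∀ i, c * (x i ^ 2 + s i ^ 2) ≤ (x i * s i) ^ 2 - (μ * θ * E i i) ^ 2 := by
    intro i
    have h1 : c * (x i ^ 2 + s i ^ 2) ≤ c * M := mul_le_mul_of_nonneg_left (hT i) hcpos.le
    have h2 : -(1 / 3) ≤ θ * E i i := by
      have := (abs_le.mp (hE i)).1
      nlinarith
    rw [hxs i]
    nlinarith [mul_le_mul_of_nonneg_left h2 (sq_nonneg μ)]
  have hEd : E = Matrix.diagonal (fun i => E i i) := hEdiag.diagonal_diag.symm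
  have hquad : ∀ v : Fin n ⊕ Fin n → ℝ, v ⬝ᵥ (Ψ₁ *ᵥ v) =
      ∑ i, (s i ^ 2 * v (Sum.inl i) ^ 2 - 2 * (μ * θ * E i i) * v (Sum.inl i) * v (Sum.inr i)
        + x i ^ 2 * v (Sum.inr i) ^ 2) := by
    intro v
    rw [hΨ₁, hX, hS, Matrix.diagonal_pow, Matrix.diagonal_pow, Matrix.fromBlocks_mulVec, hEd]
    simp only [dotProduct, Fintype.sum_sum_type, Sum.elim_inl, Sum.elim_inr, Pi.add_apply,
      Matrix.neg_mulVec, Matrix.smul_mulVec, Matrix.mulVec_diagonal, Pi.neg_apply, Pi.smul_apply,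
      Pi.pow_apply, smul_eq_mul, Function.comp, Matrix.diagonal_apply_eq]
    rw [← Finset.sum_add_distrib]
    exact Finset.sum_congr rfl fun i _ => by ring
  have hlow : ∀ v : Fin n ⊕ Fin n → ℝ, c * (v ⬝ᵥ v) ≤ v ⬝ᵥ (Ψ₁ *ᵥ v) := by
    intro v
    rw [hquad, dotProduct, Fintype.sum_sum_type, ← Finset.sum_add_distrib, Finset.mul_sum]
    refine Finset.sum_le_sum fun i _ => ?_
    have := psi_scalar (x i) (s i) c (μ * θ * E i i) (v (Sum.inl i)) (v (Sum.inr i))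
      (hx i) (hs i) hcpos (hdet i)
    linarith
  have hvpos : ∀ v : Fin n ⊕ Fin n → ℝ, v ≠ 0 → 0 < v ⬝ᵥ v := by
    intro v hv
    have h := Matrix.dotProduct_star_self_pos_iff.mpr hv
    simpa using h
  have hherm : Ψ₁.IsHermitian := by
    rw [hΨ₁, hX, hS, hEd]
    simp [Matrix.IsHermitian, Matrix.fromBlocks_transpose, Matrix.diagonal_pow]
  refine ⟨Matrix.PosDef.of_dotProduct_mulVec_pos hherm fun v hv => ?_, fun q hq => ?_⟩
  · have := mul_pos hcpos (hvpos v hv)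
    have h2 := hlow v
    simp only [star_trivial]
    linarith
  · rw [← Matrix.spectrum_toLin', ← Module.End.hasEigenvalue_iff_mem_spectrum] at hq
    obtain ⟨v, hv⟩ := hq.exists_hasEigenvector
    have h1 : Ψ₁ *ᵥ v = q • v := by
      have := hv.apply_eq_smul
      rwa [Matrix.toLin'_apply] at this
    have h2 := hlow v
    rw [h1, dotProduct_smul, smul_eq_mul] at h2
    exact le_of_mul_le_mul_right h2 (hvpos v hv.2)
end

section
/- Let Q ∈ ℝ^{n×n} be symmetric positive semidefinite, let x, s ∈ ℝⁿ with x, s > 0, μ > 0, x_i s_i = μ(1 + θE_{ii}) with E diagonal, |E_{ii}| ≤ 1, and 0 < θ ≤ 1/(3√n), n ≥ 1. Let Ψ = Ψ₁ + Ψ₂ where Ψ₁ = [S², −μθE; −μθE, X²] and Ψ₂ = [2μQ, 0; 0, 0]. Then Ψ is symmetric positive definite and its condition number satisfies κ(Ψ) ≤ 3ω²(ω² + √2·μ + 2μ·σ_max(Q)) / μ², where ω = max_i max{x_i, s_i} and σ_max(Q) is the largest eigenvalue of Q. -/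
open Matrix BigOperators

lemma aux_two {a b d t u w : ℝ} (ha : 0 ≤ a - t) (hb : 0 ≤ b - t)
    (h : d ^ 2 ≤ (a - t) * (b - t)) : t * (u^2 + w^2) ≤ a * u^2 - 2*d*u*w + b*w^2 := by
  rcases ha.eq_or_lt with h0 | h0
  · rw [← h0] at h
    have : d = 0 := by nlinarith [sq_nonneg d]
    subst this
    nlinarith [mul_nonneg hb (sq_nonneg w), sq_nonneg u]
  · have h1 : 0 ≤ (a - t) * ((a - t) * u^2 - 2*d*u*w + (b-t)*w^2) := by
      nlinarith [sq_nonneg ((a-t)*u - d*w), mul_nonneg (sub_nonneg.2 h) (sq_nonneg w)]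
    have := nonneg_of_mul_nonneg_right h1 h0
    linarith

lemma aux_up {a b d L u w : ℝ} {δ : ℝ} (ha : a + δ ≤ L) (hb : b + δ ≤ L)
    (hd : |d| ≤ δ) : a * u^2 - 2*d*u*w + b*w^2 ≤ L * (u^2 + w^2) := by
  obtain ⟨h1, h2⟩ := abs_le.1 hd
  nlinarith [mul_nonneg (sub_nonneg.2 ha) (sq_nonneg u), mul_nonneg (sub_nonneg.2 hb) (sq_nonneg w),
    mul_nonneg (sub_nonneg.2 h2) (sq_nonneg (u-w)), mul_nonneg (by linarith : 0 ≤ d + δ) (sq_nonneg (u+w))]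

lemma aux_big {a b d μ W : ℝ} (hμ : 0 < μ) (ha0 : 0 < a) (hb0 : 0 < b) (haW : a ≤ W) (hbW : b ≤ W)
    (hab : a * b = (μ + d)^2) (hd : |d| ≤ 0.24 * μ) :
    0 ≤ a - μ^2/(3*W) ∧ 0 ≤ b - μ^2/(3*W) ∧
      d^2 ≤ (a - μ^2/(3*W)) * (b - μ^2/(3*W)) := by
  obtain ⟨h1, h2⟩ := abs_le.1 hd
  have hW : 0 < W := by linarith
  have hp : μ^2/3 ≤ (μ+d)^2 := by nlinarith
  refine ⟨?_, ?_, ?_⟩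
  · rw [sub_nonneg, div_le_iff₀ (by positivity)]; nlinarith
  · rw [sub_nonneg, div_le_iff₀ (by positivity)]; nlinarith
  have hpos : 0 < μ + d := by linarith
  have hWp : (μ+d)^2 ≤ W^2 := by nlinarith
  have hk : (μ+d) * |d| ≤ (μ+d)^2 - μ^2/3 := by
    rcases abs_cases d with ⟨h, h'⟩ | ⟨h, h'⟩ <;> rw [h] <;> nlinarith
  have hk2 : (μ+d)^2 * d^2 ≤ ((μ+d)^2 - μ^2/3)^2 := by
    have := mul_self_le_mul_self (by positivity) hk
    nlinarith [sq_abs d]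
  set t := μ^2/(3*W) with ht
  have htW : t * W = μ^2/3 := by rw [ht]; field_simp
  have ht0 : 0 < t := by positivity
  have hsum : W * (a + b) ≤ W^2 + (μ+d)^2 := by nlinarith
  have key : d^2 * W^2 ≤ (a - t) * (b - t) * W^2 := by
    have e : (a - t) * (b - t) * W^2 = (μ+d)^2 * W^2 - (μ^2/3) * (W * (a+b)) + (μ^2/3)^2 := by
      rw [← htW, ← hab]; ring
    rw [e]
    have h3 : (μ^2/3) * (W * (a+b)) ≤ (μ^2/3) * (W^2 + (μ+d)^2) := by gcongr
    set m := μ^2/3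
    set P := (μ+d)^2
    have hP : 0 < P := by positivity
    have h4 : 0 ≤ P - m - d^2 := by
      have : d^2 ≤ |d| * (μ+d) := by
        rw [← sq_abs d, sq]; gcongr
        exact hd.trans (by linarith)
      linarith
    have h5 := mul_nonneg h4 (sub_nonneg.2 hWp)
    nlinarith
  exact le_of_mul_le_mul_right key (by positivity)

lemma aux_eig {m : Type*} [Fintype m] [DecidableEq m] {A : Matrix m m ℝ} (hA : A.IsHermitian) (i : m) :
    ∃ v : m → ℝ, v ⬝ᵥ v = 1 ∧ v ⬝ᵥ (A *ᵥ v) = hA.eigenvalues i := by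
  have h1 : (hA.eigenvectorBasis i).ofLp ⬝ᵥ (hA.eigenvectorBasis i).ofLp = 1 := by
    have := hA.eigenvectorBasis.orthonormal.1 i
    have h2 : inner ℝ (hA.eigenvectorBasis i) (hA.eigenvectorBasis i) = (1:ℝ) := by
      rw [real_inner_self_eq_norm_sq, this]; norm_num
    rw [EuclideanSpace.inner_eq_star_dotProduct] at h2
    simpa only [star_trivial] using h2
  refine ⟨_, h1, ?_⟩
  rw [hA.mulVec_eigenvectorBasis, dotProduct_smul, h1]; simp

lemma aux_sup {m : Type*} [Fintype m] [DecidableEq m] {A : Matrix m m ℝ} (hA : A.IsHermitian)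
    (v : m → ℝ) : v ⬝ᵥ (A *ᵥ v) ≤ (⨆ i, hA.eigenvalues i) * (v ⬝ᵥ v) := by
  set σ := ⨆ i, hA.eigenvalues i
  set b := hA.eigenvectorBasis
  set V : EuclideanSpace ℝ m := WithLp.toLp 2 v
  have e1 : v ⬝ᵥ v = ∑ i, (inner ℝ (b i) V)^2 := by
    have := b.sum_inner_mul_inner V V
    rw [EuclideanSpace.inner_eq_star_dotProduct] at this
    simp only [V, star_trivial] at this
    rw [← this]
    refine Finset.sum_congr rfl fun i _ => ?_
    rw [real_inner_comm (b i), sq]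
  have e2 : v ⬝ᵥ (A *ᵥ v) = ∑ i, hA.eigenvalues i * (inner ℝ (b i) V)^2 := by
    have := b.sum_inner_mul_inner V (WithLp.toLp 2 (A *ᵥ v))
    rw [EuclideanSpace.inner_eq_star_dotProduct] at this
    simp only [V, star_trivial] at this
    rw [dotProduct_comm, ← this]
    refine Finset.sum_congr rfl fun i _ => ?_
    have h3 : inner ℝ (b i) (WithLp.toLp 2 (A *ᵥ v)) = hA.eigenvalues i * inner ℝ (b i) V := by
      simp only [EuclideanSpace.inner_eq_star_dotProduct, star_trivial, V]
      have hT : Aᵀ = A := by simpa [conjTranspose_eq_transpose_of_trivial] using hA.eq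
      rw [dotProduct_comm, dotProduct_mulVec, ← mulVec_transpose, hT,
        hA.mulVec_eigenvectorBasis, smul_dotProduct, dotProduct_comm]
      simp [b]
    rw [h3, real_inner_comm (b i)]; ring
  rw [e1, e2, Finset.mul_sum]
  refine Finset.sum_le_sum fun i _ => ?_
  gcongr
  exact le_ciSup (Set.finite_range _).bddAbove i

lemma aux_core {m : Type*} [Fintype m] [DecidableEq m] [Nonempty m] {A : Matrix m m ℝ}
    (hA : A.IsHermitian) {t L R : ℝ} (ht : 0 < t)
    (hlo : ∀ v, t * (v ⬝ᵥ v) ≤ v ⬝ᵥ (A *ᵥ v)) (hhi : ∀ v, v ⬝ᵥ (A *ᵥ v) ≤ L * (v ⬝ᵥ v))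
    (hR : L / t ≤ R) : A.PosDef ∧ ∀ h : A.IsHermitian,
      (⨆ i, h.eigenvalues i) / (⨅ i, h.eigenvalues i) ≤ R := by
  have h1 : ∀ i, t ≤ hA.eigenvalues i := fun i => by
    obtain ⟨v, h, h'⟩ := aux_eig hA i
    have := hlo v; rw [h, h'] at this; linarith
  have h2 : ∀ i, hA.eigenvalues i ≤ L := fun i => by
    obtain ⟨v, h, h'⟩ := aux_eig hA i
    have := hhi v; rw [h, h'] at this; linarith
  refine ⟨hA.posDef_iff_eigenvalues_pos.2 fun i => ht.trans_le (h1 i), fun h => le_trans ?_ hR⟩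
  have h0 : 0 ≤ L := ht.le.trans ((h1 (Classical.arbitrary m)).trans (h2 _))
  exact div_le_div₀ h0 (ciSup_le h2) ht (le_ciInf h1)

lemma aux_form {n : ℕ} (Q : Matrix (Fin n) (Fin n) ℝ) (x s e : Fin n → ℝ) (c k : ℝ)
    (v : Fin n ⊕ Fin n → ℝ) :
    v ⬝ᵥ ((fromBlocks (diagonal s ^ 2) (-(c • diagonal e)) (-(c • diagonal e)) (diagonal x ^ 2)
      + fromBlocks (k • Q) 0 0 0) *ᵥ v) =
    (∑ i, (s i^2 * v (.inl i)^2 - 2 * (c * e i) * v (.inl i) * v (.inr i) + x i^2 * v (.inr i)^2))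
      + k * ((v ∘ .inl) ⬝ᵥ (Q *ᵥ (v ∘ .inl))) := by
  rw [add_mulVec, dotProduct_add, fromBlocks_mulVec, fromBlocks_mulVec]
  congr 1
  · simp only [dotProduct, Fintype.sum_sum_type, Sum.elim_inl, Sum.elim_inr, Pi.add_apply, neg_mulVec,
      smul_mulVec, diagonal_pow, mulVec_diagonal, Pi.neg_apply, Pi.smul_apply, smul_eq_mul,
      Pi.pow_apply, Function.comp, ← Finset.sum_add_distrib]
    refine Finset.sum_congr rfl fun i _ => ?_
    ring
  · simp only [dotProduct, Fintype.sum_sum_type, Sum.elim_inl, Sum.elim_inr, Pi.add_apply, 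
      smul_mulVec, zero_mulVec, Pi.zero_apply, Pi.smul_apply, smul_eq_mul, Finset.mul_sum]
    simp
    refine Finset.sum_congr rfl fun i _ => ?_
    ring

lemma aux_one {a b d μ W q : ℝ} (hμ : 0 < μ) (ha0 : 0 < a) (hb0 : 0 < b) (haW : a ≤ W) (hbW : b ≤ W)
    (hab : a * b = (μ + d)^2) (hd : |d| ≤ μ / 3) (hq : 0 ≤ q) :
    ∃ t, 0 < t ∧ 0 ≤ a + q - t ∧ 0 ≤ b - t ∧ d^2 ≤ (a + q - t) * (b - t) ∧
      (W + q + μ/3) / t ≤ 3 * W * (W + Real.sqrt 2 * μ + q) / μ^2 := by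
  obtain ⟨h1, h2⟩ := abs_le.1 hd
  have hW : 0 < W := by linarith
  have hWp : (μ+d)^2 ≤ W^2 := by nlinarith
  have hWp' : μ + d ≤ W := by nlinarith
  set L := W + q + μ/3 with hL
  have hL0 : 0 < L := by positivity
  set D := (a + q) * b - d^2 with hD
  have hD1 : μ^2/3 + q * b ≤ D := by nlinarith
  have hD0 : 0 < D := lt_of_lt_of_le (by positivity) hD1
  have hd2 : 0 ≤ d^2 := sq_nonneg d
  have hchi : d^2 ≤ (L - (a+q)) * (L - b) := by
    have e1 : μ/3 ≤ L - (a+q) := by linarith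
    have e2 : μ/3 ≤ L - b := by linarith
    nlinarith [mul_le_mul e1 e2 (by positivity) (by linarith)]
  have htL : D / L * L = D := by field_simp
  refine ⟨D / L, by positivity, ?_, ?_, ?_, ?_⟩
  · rw [sub_nonneg, div_le_iff₀ hL0]
    have : b ≤ L := by linarith
    nlinarith [mul_le_mul_of_nonneg_left this (by positivity : 0 ≤ a + q)]
  · rw [sub_nonneg, div_le_iff₀ hL0]
    have : a + q ≤ L := by linarith
    nlinarith [mul_le_mul_of_nonneg_left this hb0.le]
  · have e : (a + q - D/L) * (b - D/L) - d^2 = D / L^2 * ((L - (a+q)) * (L - b) - d^2) := by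
      field_simp
      rw [hD]; ring
    have := mul_nonneg (by positivity : 0 ≤ D / L^2) (sub_nonneg.2 hchi)
    linarith
  · rw [div_div_eq_mul_div, div_le_div_iff₀ hD0 (by positivity)]
    have hr : (1.4:ℝ) ≤ Real.sqrt 2 := Real.le_sqrt_of_sq_le (by norm_num)
    have hWb : (μ*(2/3))^2 ≤ W * b := by nlinarith
    have hWD : μ^2 * (W + 4/3 * q) ≤ 3 * W * D := by
      nlinarith [mul_le_mul_of_nonneg_left hD1 hW.le, mul_le_mul_of_nonneg_left hWb hq]
    have hm : L * L ≤ (W + 4/3*q) * (W + Real.sqrt 2 * μ + q) := by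
      have : (W + 4/3*q) * (W + 1.4 * μ + q) ≤ (W + 4/3*q) * (W + Real.sqrt 2 * μ + q) := by gcongr
      refine le_trans ?_ this
      rw [hL]
      have hWm : μ * (2/3) ≤ W := by linarith
      nlinarith [mul_nonneg hq hW.le, mul_nonneg hq hμ.le, mul_nonneg hμ.le (sub_nonneg.2 hWm), sq_nonneg q]
    calc L * L * μ^2 ≤ ((W + 4/3*q) * (W + Real.sqrt 2 * μ + q)) * μ^2 := by gcongr
      _ = (μ^2 * (W + 4/3 * q)) * (W + Real.sqrt 2 * μ + q) := by ring
      _ ≤ (3 * W * D) * (W + Real.sqrt 2 * μ + q) := by gcongr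
      _ = _ := by ring

/-- Under the central-path neighbourhood conditions with `0 < θ ≤ 1/(3√n)`
and `Q` symmetric positive semidefinite, the middle matrix
`Ψ = Ψ₁ + Ψ₂ = [S² + 2μQ, −μθE; −μθE, X²]` is symmetric positive definite and its condition
number (ratio of largest to smallest eigenvalue) is at most
`3ω²(ω² + √2·μ + 2μ·σ_max(Q)) / μ²`, where `ω = maxᵢ max{xᵢ, sᵢ}`. -/
theorem Psi_posdef_and_cond_bound {n : ℕ} (hn : 0 < n)
    (Q : Matrix (Fin n) (Fin n) ℝ) (hQ : Q.PosSemidef)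
    (x s : Fin n → ℝ) (hx : ∀ i, 0 < x i) (hs : ∀ i, 0 < s i)
    (μ θ : ℝ) (hμ : 0 < μ)
    (E : Matrix (Fin n) (Fin n) ℝ) (hEdiag : E.IsDiag) (hE : ∀ i, |E i i| ≤ 1)
    (hxs : ∀ i, x i * s i = μ * (1 + θ * E i i))
    (hθ0 : 0 < θ) (hθ : θ ≤ 1 / (3 * Real.sqrt n))
    (X S : Matrix (Fin n) (Fin n) ℝ)
    (hX : X = Matrix.diagonal x) (hS : S = Matrix.diagonal s)
    (Ψ₁ Ψ₂ Ψ : Matrix (Fin n ⊕ Fin n) (Fin n ⊕ Fin n) ℝ)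
    (hΨ₁ : Ψ₁ = fromBlocks (S ^ 2) (-((μ * θ) • E)) (-((μ * θ) • E)) (X ^ 2))
    (hΨ₂ : Ψ₂ = fromBlocks ((2 * μ) • Q) 0 0 0)
    (hΨ : Ψ = Ψ₁ + Ψ₂)
    (ω : ℝ) (hω : ω = ⨆ i, max (x i) (s i)) :
    Ψ.PosDef ∧
      ∀ (hΨherm : Ψ.IsHermitian),
        (⨆ i, hΨherm.eigenvalues i) / (⨅ i, hΨherm.eigenvalues i) ≤
          3 * ω ^ 2 * (ω ^ 2 + Real.sqrt 2 * μ + 2 * μ * (⨆ i, hQ.1.eigenvalues i)) / μ ^ 2 := by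
  have hne : Nonempty (Fin n) := ⟨⟨0, hn⟩⟩
  have hEd : E = diagonal (fun i => E i i) := hEdiag.diagonal_diag.symm
  have hsq1 : 1 ≤ Real.sqrt n := by
    rw [Real.one_le_sqrt]; exact_mod_cast hn
  have hθ3 : θ ≤ 1/3 := hθ.trans (by
    rw [div_le_div_iff₀ (by positivity) (by norm_num)]; linarith)
  have hσ : 0 ≤ ⨆ i, hQ.1.eigenvalues i := Real.iSup_nonneg fun i => hQ.eigenvalues_nonneg i
  have hQup := aux_sup hQ.1
  have hQlo : ∀ v, 0 ≤ v ⬝ᵥ (Q *ᵥ v) := fun v => by simpa using hQ.dotProduct_mulVec_nonneg v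
  set σ := ⨆ i, hQ.1.eigenvalues i
  have hωi : ∀ i, max (x i) (s i) ≤ ω := fun i => by
    rw [hω]; exact le_ciSup (f := fun i => max (x i) (s i)) (Set.finite_range _).bddAbove i
  have hxW : ∀ i, x i ^ 2 ≤ ω ^ 2 := fun i =>
    pow_le_pow_left₀ (hx i).le ((le_max_left _ _).trans (hωi i)) 2
  have hsW : ∀ i, s i ^ 2 ≤ ω ^ 2 := fun i =>
    pow_le_pow_left₀ (hs i).le ((le_max_right _ _).trans (hωi i)) 2
  have hprod : ∀ i, s i ^ 2 * x i ^ 2 = (μ + μ * θ * E i i) ^ 2 := fun i => by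
    rw [← mul_pow, mul_comm, hxs]; ring
  have hdθ : ∀ i, |μ * θ * E i i| ≤ θ * μ := fun i => by
    rw [abs_mul, abs_of_pos (by positivity : 0 < μ * θ)]
    nlinarith [hE i, mul_pos hμ hθ0]
  have hform := aux_form Q x s (fun i => E i i) (μ * θ) (2 * μ)
  rw [← hEd, ← hX, ← hS, ← hΨ₁, ← hΨ₂, ← hΨ] at hform
  have hnorm : ∀ v : Fin n ⊕ Fin n → ℝ,
      v ⬝ᵥ v = ∑ i, (v (.inl i) ^ 2 + v (.inr i) ^ 2) := fun v => by
    simp only [dotProduct, Fintype.sum_sum_type, ← Finset.sum_add_distrib, sq]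
  have hherm : Ψ.IsHermitian := by
    have hET : Eᵀ = E := by rw [hEd]; exact diagonal_transpose _
    have hQT : Qᵀ = Q := by simpa [conjTranspose_eq_transpose_of_trivial] using hQ.1.eq
    rw [IsHermitian, conjTranspose_eq_transpose_of_trivial, hΨ, hΨ₁, hΨ₂, hX, hS]
    simp [fromBlocks_transpose, hET, hQT, diagonal_pow]
  have hW0 : 0 < ω ^ 2 := lt_of_lt_of_le (pow_pos (hx ⟨0, hn⟩) 2) (hxW _)
  have hr : (1.4:ℝ) ≤ Real.sqrt 2 := Real.le_sqrt_of_sq_le (by norm_num)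
  rcases Nat.lt_or_ge n 2 with h1 | h2
  · obtain rfl : n = 1 := by omega
    have hQ1 : ∀ u : Fin 1 → ℝ, u ⬝ᵥ (Q *ᵥ u) = Q 0 0 * u 0 ^ 2 := fun u => by
      simp [dotProduct, mulVec]; ring
    have hq0 : 0 ≤ Q 0 0 := by simpa [hQ1] using hQlo (fun _ => 1)
    have hqσ : Q 0 0 ≤ σ := by
      have := hQup (fun _ => 1)
      rw [hQ1] at this
      simpa [dotProduct] using this
    have hd3 : |μ * θ * E 0 0| ≤ μ / 3 := (hdθ 0).trans (by nlinarith)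
    obtain ⟨t, ht, ha, hb, hab, hR⟩ := aux_one (q := 2 * μ * Q 0 0) hμ (pow_pos (hs 0) 2)
      (pow_pos (hx 0) 2) (hsW 0) (hxW 0) (hprod 0) hd3 (by positivity)
    refine aux_core hherm (L := ω ^ 2 + 2 * μ * Q 0 0 + μ / 3) ht ?_ ?_ (hR.trans ?_)
    · intro v
      rw [hform, hnorm, hQ1]
      have := aux_two (u := v (.inl 0)) (w := v (.inr 0)) ha hb hab
      simp only [Fin.sum_univ_one, Function.comp]
      linarith
    · intro v
      rw [hform, hnorm, hQ1]
      have := aux_up (u := v (.inl 0)) (w := v (.inr 0)) (a := s 0 ^ 2 + 2 * μ * Q 0 0)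
        (b := x 0 ^ 2) (L := ω ^ 2 + 2 * μ * Q 0 0 + μ / 3)
        (by linarith [hsW 0]) (by linarith [hxW 0, mul_nonneg hμ.le hq0]) hd3
      simp only [Fin.sum_univ_one, Function.comp]
      linarith
    · gcongr
  · have hθ24 : θ ≤ 0.24 := hθ.trans (by
      have : Real.sqrt 2 ≤ Real.sqrt n := Real.sqrt_le_sqrt (by exact_mod_cast h2)
      rw [div_le_iff₀ (by positivity)]; linarith)
    have hd : ∀ i, |μ * θ * E i i| ≤ 0.24 * μ := fun i => (hdθ i).trans (by gcongr)
    refine aux_core hherm (t := μ ^ 2 / (3 * ω ^ 2)) (L := ω ^ 2 + 0.24 * μ + 2 * μ * σ)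
      (by positivity) ?_ ?_ ?_
    · intro v
      rw [hform, hnorm, Finset.mul_sum]
      refine le_add_of_le_of_nonneg (Finset.sum_le_sum fun i _ => ?_)
        (mul_nonneg (by positivity) (hQlo _))
      obtain ⟨ha, hb, hab⟩ := aux_big hμ (pow_pos (hs i) 2)
        (pow_pos (hx i) 2) (hsW i) (hxW i) (hprod i) (hd i)
      exact aux_two ha hb hab
    · intro v
      rw [hform, add_mul]
      refine add_le_add ?_ ?_
      · rw [hnorm, Finset.mul_sum]
        refine Finset.sum_le_sum fun i _ => ?_
        exact aux_up (by linarith [hsW i]) (by linarith [hxW i]) (hd i)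
      · rw [mul_assoc (2 * μ)]
        refine mul_le_mul_of_nonneg_left ((hQup _).trans ?_) (by positivity)
        refine mul_le_mul_of_nonneg_left ?_ hσ
        rw [hnorm]
        simp only [dotProduct, Function.comp]
        exact Finset.sum_le_sum fun i _ => by nlinarith [sq_nonneg (v (.inr i))]
    · rw [div_div_eq_mul_div, mul_comm]
      gcongr
      linarith
end
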